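/- Let A ⊆ ℕ^n be an affine semigroup and p a prime. Then *pA ≠ ⁺A if and only if there exist a subset S ⊆ {1,…,s} and a vector v ∈ G(A) whose image in ℝ^n lies in the ℝ-linear span of {a_i : i ∈ S}, such that v ∉ G(A ∩ F_S) and p•v ∈ G(A ∩ F_S). (Equivalently, (p) is an associated prime of the ℤ-module (G(A) ∩ ℝF)/G(A ∩ F) for some face F of C(A).) -/

import Mathlib

/-- The coordinatewise embedding of `ℤ^n` into `ℝ^n`. -/
noncomputable def toR {n : ℕ} (v : Fin n → ℤ) : Fin n → ℝ := fun i => (v i : ℝ)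

/-- The normalization (saturation) `Ā` of an affine semigroup `A ⊆ ℤ^n`:
the elements `v` of the group `G(A)` generated by `A` such that `m • v ∈ A`
for some positive integer `m`. -/
def normalization {n : ℕ} (A : AddSubmonoid (Fin n → ℤ)) : Set (Fin n → ℤ) :=
  {v | v ∈ AddSubgroup.closure (A : Set (Fin n → ℤ)) ∧ ∃ m : ℕ, 0 < m ∧ m • v ∈ A}

/-- The seminormalization `⁺A`: elements `v ∈ G(A)` with `m • v ∈ A` and `m' • v ∈ A`
for some coprime positive integers `m, m'`. -/
def seminormalization {n : ℕ} (A : AddSubmonoid (Fin n → ℤ)) : Set (Fin n → ℤ) :=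
  {v | v ∈ AddSubgroup.closure (A : Set (Fin n → ℤ)) ∧
    ∃ m m' : ℕ, 0 < m ∧ 0 < m' ∧ Nat.Coprime m m' ∧ m • v ∈ A ∧ m' • v ∈ A}

/-- The `p`-weak normalization `*pA`: elements `v ∈ Ā` with `p ^ e • v ∈ A` for some `e`. -/
def pWeakNormalization {n : ℕ} (A : AddSubmonoid (Fin n → ℤ)) (p : ℕ) : Set (Fin n → ℤ) :=
  {v | v ∈ normalization A ∧ ∃ e : ℕ, p ^ e • v ∈ A}

/-- The quotient `⟦A/m⟧ = {v ∈ Ā : m • v ∈ A}`. -/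
def quotBy {n : ℕ} (A : AddSubmonoid (Fin n → ℤ)) (m : ℕ) : Set (Fin n → ℤ) :=
  {v | v ∈ normalization A ∧ m • v ∈ A}

/-- The face `F_S` of the cone `C(A)`: all `ℝ≥0`-linear combinations of `{a i : i ∈ S}`. -/
def face {n s : ℕ} (a : Fin s → (Fin n → ℤ)) (S : Finset (Fin s)) : Set (Fin n → ℝ) :=
  {x | ∃ c : Fin s → ℝ, (∀ i, 0 ≤ c i) ∧ x = ∑ i ∈ S, c i • toR (a i)}

/-- The interior `int(F_S)` of the face `F_S`: all strictly positive `ℝ`-linear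
combinations of `{a i : i ∈ S}`. -/
def faceInt {n s : ℕ} (a : Fin s → (Fin n → ℤ)) (S : Finset (Fin s)) : Set (Fin n → ℝ) :=
  {x | ∃ c : Fin s → ℝ, (∀ i ∈ S, 0 < c i) ∧ x = ∑ i ∈ S, c i • toR (a i)}

/-- `G(A ∩ F_S)`: the subgroup of `ℤ^n` generated by the elements of `A`
whose image in `ℝ^n` lies in the face `F_S`. -/
def faceGroup {n s : ℕ} (A : AddSubmonoid (Fin n → ℤ)) (a : Fin s → (Fin n → ℤ))
    (S : Finset (Fin s)) : AddSubgroup (Fin n → ℤ) :=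
  AddSubgroup.closure {v | v ∈ A ∧ toR v ∈ face a S}

/-- A finite set of positive reals can be sent to positive rationals by a `ℚ`-linear functional. -/
lemma exists_rat_functional_pos (T : Finset ℝ) (hT : ∀ t ∈ T, 0 < t) :
    ∃ f : ℝ →ₗ[ℚ] ℚ, ∀ t ∈ T, 0 < f t := by
  let b := Module.Basis.ofVectorSpace ℚ ℝ
  let ev : ℝ → (Module.Basis.ofVectorSpaceIndex ℚ ℝ → ℝ) → ℝ :=
    fun t x => ∑ j ∈ (b.repr t).support, (b.repr t j : ℝ) * x j
  have hopen : IsOpen (⋂ t ∈ T, {x | 0 < ev t x}) := by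
    refine isOpen_biInter_finset fun t _ => isOpen_lt continuous_const ?_
    fun_prop
  have hne : (⋂ t ∈ T, {x | 0 < ev t x}).Nonempty := by
    refine ⟨fun j => b j, Set.mem_iInter₂.2 fun t ht => ?_⟩
    have h := b.linearCombination_repr t
    rw [Finsupp.linearCombination_apply, Finsupp.sum] at h
    have h' : ev t (fun j => b j) = t := by
      simpa only [ev, Rat.smul_def] using h
    simpa [h'] using hT t ht
  have hdense : DenseRange (Pi.map fun _ : Module.Basis.ofVectorSpaceIndex ℚ ℝ =>
      ((↑) : ℚ → ℝ)) := DenseRange.piMap fun _ => Rat.denseRange_cast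
  obtain ⟨g, hg⟩ := hdense.exists_mem_open hopen hne
  refine ⟨b.constr ℚ g, fun t ht => ?_⟩
  have h := Set.mem_iInter₂.1 hg t ht
  have h' : ev t (Pi.map (fun _ => ((↑) : ℚ → ℝ)) g) = ((b.constr ℚ g t : ℚ) : ℝ) := by
    simp [ev, Module.Basis.constr_apply, Finsupp.sum, Pi.map_apply]
  rw [Set.mem_ofPred_eq, h'] at h
  exact_mod_cast h

lemma toR_add {n : ℕ} (v w : Fin n → ℤ) : toR (v + w) = toR v + toR w := by
  ext i; simp [toR]

lemma toR_nsmul {n : ℕ} (k : ℕ) (v : Fin n → ℤ) : toR (k • v) = (k : ℝ) • toR v := by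
  ext i; simp [toR]

lemma zero_mem_face {n s : ℕ} (a : Fin s → (Fin n → ℤ)) (S : Finset (Fin s)) :
    0 ∈ face a S := ⟨0, by simp, by simp⟩

lemma add_mem_face {n s : ℕ} {a : Fin s → (Fin n → ℤ)} {S : Finset (Fin s)} {x y : Fin n → ℝ}
    (hx : x ∈ face a S) (hy : y ∈ face a S) : x + y ∈ face a S := by
  obtain ⟨c, hc, rfl⟩ := hx
  obtain ⟨d, hd, rfl⟩ := hy
  exact ⟨c + d, fun i => add_nonneg (hc i) (hd i), by simp [add_smul, Finset.sum_add_distrib]⟩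

lemma smul_mem_face {n s : ℕ} {a : Fin s → (Fin n → ℤ)} {S : Finset (Fin s)} {x : Fin n → ℝ}
    {r : ℝ} (hr : 0 ≤ r) (hx : x ∈ face a S) : r • x ∈ face a S := by
  obtain ⟨c, hc, rfl⟩ := hx
  exact ⟨r • c, fun i => mul_nonneg hr (hc i), by simp [Finset.smul_sum, mul_smul]⟩

lemma mem_face_of_nsmul_mem_face {n s : ℕ} {a : Fin s → (Fin n → ℤ)} {S : Finset (Fin s)}
    {v : Fin n → ℤ} {k : ℕ} (hk : 0 < k) (hv : toR (k • v) ∈ face a S) : toR v ∈ face a S := by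
  have h := smul_mem_face (r := (k : ℝ)⁻¹) (by positivity) hv
  rwa [toR_nsmul, smul_smul, inv_mul_cancel₀ (by positivity), one_smul] at h

/-- The submonoid `A ∩ F_S`. -/
def faceSubmonoid {n s : ℕ} (A : AddSubmonoid (Fin n → ℤ)) (a : Fin s → (Fin n → ℤ))
    (S : Finset (Fin s)) : AddSubmonoid (Fin n → ℤ) where
  carrier := {v | v ∈ A ∧ toR v ∈ face a S}
  zero_mem' := ⟨A.zero_mem, by
    have h : toR (0 : Fin n → ℤ) = 0 := by ext i; simp [toR]
    rw [h]; exact zero_mem_face a S⟩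
  add_mem' hx hy := ⟨A.add_mem hx.1 hy.1, by rw [toR_add]; exact add_mem_face hx.2 hy.2⟩

/-- An integer point of `F_S` has a positive multiple in the monoid generated by `{a i : i ∈ S}`. -/
lemma exists_nsmul_eq_sum_of_mem_face {n s : ℕ} {a : Fin s → (Fin n → ℤ)} {S : Finset (Fin s)}
    {y : Fin n → ℤ} (hy : toR y ∈ face a S) :
    ∃ k : ℕ, 0 < k ∧ ∃ c : Fin s → ℕ, k • y = ∑ i ∈ S, c i • a i := by
  obtain ⟨c, hc, hyc⟩ := hy
  obtain ⟨f, hf⟩ := exists_rat_functional_pos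
    ((insert 1 (Finset.univ.image c)).filter fun t => 0 < t) fun t ht => (Finset.mem_filter.1 ht).2
  have hf1 : 0 < f 1 := hf 1 (by simp)
  have hfc : ∀ i, 0 ≤ f (c i) := by
    intro i
    rcases (hc i).eq_or_lt with h | h
    · simp [← h]
    · exact (hf _ (by simp [h])).le
  have hcoord : ∀ l, (y l : ℚ) * f 1 = ∑ i ∈ S, f (c i) * a i l := by
    intro l
    have h := congrFun hyc l
    have h1 : f (toR y l) = (y l : ℚ) * f 1 := by
      have : toR y l = (y l : ℤ) • (1 : ℝ) := by simp [toR]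
      rw [this, map_zsmul]; simp
    rw [← h1, h, Finset.sum_apply, map_sum]
    refine Finset.sum_congr rfl fun i _ => ?_
    have : (c i • toR (a i)) l = (a i l : ℤ) • c i := by simp [toR, mul_comm]
    rw [this, map_zsmul]; simp [mul_comm]
  obtain ⟨⟨D, hD⟩, hint⟩ := IsLocalization.exist_integer_multiples_of_finset (nonZeroDivisors ℤ)
    (insert (f 1) (Finset.univ.image fun i => f (c i)))
  have hD0 : D ≠ 0 := nonZeroDivisors.ne_zero hD
  have key : ∀ q ∈ insert (f 1) (Finset.univ.image fun i => f (c i)), 0 ≤ q →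
      ∃ m : ℕ, (m : ℚ) = |(D : ℚ)| * q := by
    intro q hq h0
    obtain ⟨z, hz⟩ := hint q hq
    refine ⟨z.natAbs, ?_⟩
    have hz' : (z : ℚ) = D * q := by simpa using hz
    rw [Nat.cast_natAbs, Int.cast_abs, hz', abs_mul, abs_of_nonneg h0]
  obtain ⟨k, hk⟩ := key (f 1) (by simp) hf1.le
  choose d hd using fun i => key (f (c i)) (by simp) (hfc i)
  have hDpos : 0 < |(D : ℚ)| := abs_pos.2 (by exact_mod_cast hD0)
  refine ⟨k, ?_, d, ?_⟩
  · have : (0 : ℚ) < k := by rw [hk]; positivity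
    exact_mod_cast this
  · ext l
    have : (k : ℚ) * y l = ∑ i ∈ S, (d i : ℚ) * a i l := by
      rw [hk, mul_assoc, mul_comm (f 1), hcoord l, Finset.mul_sum]
      exact Finset.sum_congr rfl fun i _ => by rw [hd]; ring
    simp only [Pi.smul_apply, Finset.sum_apply, nsmul_eq_mul]
    exact_mod_cast this

lemma sum_nsmul_mem_faceSubmonoid {n s : ℕ} {a : Fin s → (Fin n → ℤ)}
    {A : AddSubmonoid (Fin n → ℤ)} (hA : ∀ i, a i ∈ A) (S : Finset (Fin s)) (c : Fin s → ℕ) :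
    ∑ i ∈ S, c i • a i ∈ faceSubmonoid A a S := by
  refine sum_mem fun i hi => nsmul_mem (show a i ∈ faceSubmonoid A a S from ⟨hA i, ?_⟩) _
  refine ⟨Pi.single i 1, fun j => ?_, ?_⟩
  · by_cases h : j = i
    · subst h; simp
    · simp [h]
  · simp [Pi.single_apply, ite_smul, hi]

/-- Some multiple of a point in the interior of `F_S` dominates a given element of `A ∩ F_S`. -/
lemma exists_nsmul_sub_mem_faceSubmonoid {n s : ℕ} {a : Fin s → (Fin n → ℤ)}
    {A : AddSubmonoid (Fin n → ℤ)} (hA : ∀ i, a i ∈ A) {S : Finset (Fin s)}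
    {r : Fin s → ℕ} (hr : ∀ i ∈ S, 0 < r i) {y : Fin n → ℤ} (hy : y ∈ faceSubmonoid A a S) :
    ∃ M : ℕ, M • (∑ i ∈ S, r i • a i) - y ∈ faceSubmonoid A a S := by
  obtain ⟨k, hk, c, hc⟩ := exists_nsmul_eq_sum_of_mem_face hy.2
  refine ⟨∑ i ∈ S, c i, ?_⟩
  set M := ∑ i ∈ S, c i
  have h1 : M • (∑ i ∈ S, r i • a i) - k • y = ∑ i ∈ S, (M * r i - c i) • a i := by
    rw [hc, Finset.smul_sum, ← Finset.sum_sub_distrib]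
    refine Finset.sum_congr rfl fun i hi => ?_
    have hle : c i ≤ M * r i := (Finset.single_le_sum (fun _ _ => Nat.zero_le _) hi).trans
      (Nat.le_mul_of_pos_right _ (hr i hi))
    rw [sub_eq_iff_eq_add, ← add_smul, Nat.sub_add_cancel hle, smul_smul]
  obtain ⟨k, rfl⟩ := Nat.exists_eq_succ_of_ne_zero hk.ne'
  have h2 : M • (∑ i ∈ S, r i • a i) - y
      = ∑ i ∈ S, (M * r i - c i) • a i + k • y := by
    rw [← h1, succ_nsmul]; abel
  rw [h2]
  exact add_mem (sum_nsmul_mem_faceSubmonoid hA S _) (nsmul_mem hy _)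

lemma exists_sub_of_mem_faceGroup {n s : ℕ} {a : Fin s → (Fin n → ℤ)}
    {A : AddSubmonoid (Fin n → ℤ)} {S : Finset (Fin s)} {v : Fin n → ℤ}
    (hv : v ∈ faceGroup A a S) :
    ∃ x ∈ faceSubmonoid A a S, ∃ y ∈ faceSubmonoid A a S, v = x - y := by
  induction hv using AddSubgroup.closure_induction with
  | mem x hx => exact ⟨x, hx, 0, zero_mem _, by simp⟩
  | zero => exact ⟨0, zero_mem _, 0, zero_mem _, by simp⟩
  | add v w _ _ hv hw =>
    obtain ⟨x, hx, y, hy, rfl⟩ := hv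
    obtain ⟨x', hx', y', hy', rfl⟩ := hw
    exact ⟨x + x', add_mem hx hx', y + y', add_mem hy hy', by abel⟩
  | neg v _ hv =>
    obtain ⟨x, hx, y, hy, rfl⟩ := hv
    exact ⟨y, hy, x, hx, by abel⟩

lemma mem_faceGroup_of_mem {n s : ℕ} {a : Fin s → (Fin n → ℤ)}
    {A : AddSubmonoid (Fin n → ℤ)} {S : Finset (Fin s)} {v : Fin n → ℤ}
    (hv : v ∈ faceSubmonoid A a S) : v ∈ faceGroup A a S :=
  AddSubgroup.subset_closure hv

lemma exists_nsmul_add_mem_faceSubmonoid {n s : ℕ} {a : Fin s → (Fin n → ℤ)}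
    {A : AddSubmonoid (Fin n → ℤ)} (hA : ∀ i, a i ∈ A) {S : Finset (Fin s)}
    {r : Fin s → ℕ} (hr : ∀ i ∈ S, 0 < r i) {v : Fin n → ℤ} (hv : v ∈ faceGroup A a S) :
    ∃ M : ℕ, v + M • (∑ i ∈ S, r i • a i) ∈ faceSubmonoid A a S := by
  obtain ⟨x, hx, y, hy, rfl⟩ := exists_sub_of_mem_faceGroup hv
  obtain ⟨M, hM⟩ := exists_nsmul_sub_mem_faceSubmonoid hA hr hy
  exact ⟨M, by convert add_mem hx hM using 1; abel⟩

lemma AddSubgroup.mem_of_coprime_nsmul_mem {G : Type*} [AddCommGroup G] (H : AddSubgroup G)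
    {v : G} {m m' : ℕ} (h : Nat.Coprime m m') (hm : m • v ∈ H) (hm' : m' • v ∈ H) : v ∈ H := by
  have hb : (1 : ℤ) = m * m.gcdA m' + m' * m.gcdB m' := by
    rw [← Nat.gcd_eq_gcd_ab, h.gcd_eq_one, Nat.cast_one]
  have : v = m.gcdA m' • (m • v) + m.gcdB m' • (m' • v) := by
    rw [← natCast_zsmul v m, ← natCast_zsmul v m', smul_smul, smul_smul, ← add_smul,
      mul_comm, mul_comm (m.gcdB m'), ← hb, one_smul]
  rw [this]
  exact add_mem (H.zsmul_mem hm _) (H.zsmul_mem hm' _)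

lemma seminormalization_subset_pWeakNormalization {n : ℕ} (A : AddSubmonoid (Fin n → ℤ)) {p : ℕ}
    (hp : 1 < p) : seminormalization A ⊆ pWeakNormalization A p := by
  rintro v ⟨hv, m, m', hm, -, hco, h, h'⟩
  refine ⟨⟨hv, m, hm, h⟩, m.pred * m'.pred, ?_⟩
  obtain ⟨b, c, hbc⟩ := Nat.exists_add_mul_eq_of_gcd_dvd_of_mul_pred_le m m'
    (p ^ (m.pred * m'.pred)) (by simp [hco.gcd_eq_one]) (Nat.lt_pow_self hp).le
  rw [← hbc, add_smul, mul_smul, mul_smul]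
  exact add_mem (nsmul_mem h _) (nsmul_mem h' _)

lemma exists_faceGroup_torsion_of_notMem_seminormalization {n s : ℕ} (a : Fin s → (Fin n → ℤ))
    {p : ℕ} (hp : p.Prime) {v : Fin n → ℤ}
    (hv : v ∈ pWeakNormalization (AddSubmonoid.closure (Set.range a)) p)
    (hv' : v ∉ seminormalization (AddSubmonoid.closure (Set.range a))) :
    ∃ (S : Finset (Fin s)) (u : Fin n → ℤ),
      u ∈ AddSubgroup.closure (AddSubmonoid.closure (Set.range a) : Set (Fin n → ℤ)) ∧
      toR u ∈ Submodule.span ℝ (toR '' (a '' (S : Set (Fin s)))) ∧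
      u ∉ faceGroup (AddSubmonoid.closure (Set.range a)) a S ∧
      p • u ∈ faceGroup (AddSubmonoid.closure (Set.range a)) a S := by
  set A := AddSubmonoid.closure (Set.range a)
  have hA : ∀ i, a i ∈ A := fun i => AddSubmonoid.subset_closure ⟨i, rfl⟩
  obtain ⟨⟨hG, -⟩, e, he⟩ := hv
  obtain ⟨r, hr⟩ := AddSubmonoid.mem_closure_range_iff_of_fintype.1 he
  let S : Finset (Fin s) := Finset.univ.filter fun i => r i ≠ 0
  have hrS : ∑ i ∈ S, r i • a i = p ^ e • v := by
    rw [hr]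
    exact Finset.sum_subset (Finset.subset_univ _) fun i _ hi => by
      have : r i = 0 := by simpa [S] using hi
      simp [this]
  have hmem : p ^ e • v ∈ faceSubmonoid A a S := hrS ▸ sum_nsmul_mem_faceSubmonoid hA S r
  have hnot : v ∉ faceGroup A a S := by
    intro hvS
    obtain ⟨M, hM⟩ := exists_nsmul_add_mem_faceSubmonoid hA (r := r)
      (fun i hi => Nat.pos_of_ne_zero (Finset.mem_filter.1 hi).2) hvS
    refine hv' ⟨hG, M * p ^ e + 1, p ^ e, by omega, (pow_pos hp.pos e), by simp, ?_, he⟩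
    rw [hrS] at hM
    convert hM.1 using 1
    rw [add_smul, mul_smul, one_smul, add_comm]
  have hex : ∃ j, p ^ j • v ∈ faceGroup A a S := ⟨e, mem_faceGroup_of_mem hmem⟩
  classical
  obtain ⟨j, hj⟩ : ∃ j, Nat.find hex = j + 1 := Nat.exists_eq_succ_of_ne_zero fun h0 =>
    hnot (by simpa [h0] using Nat.find_spec hex)
  refine ⟨S, p ^ j • v, nsmul_mem hG _, ?_, Nat.find_min hex (by omega), ?_⟩
  · have hface : toR v ∈ face a S := mem_face_of_nsmul_mem_face (pow_pos hp.pos e) hmem.2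
    rw [toR_nsmul]
    refine Submodule.smul_mem _ _ ?_
    obtain ⟨c, -, hc⟩ := hface
    rw [hc]
    exact Submodule.sum_mem _ fun i hi => Submodule.smul_mem _ _
      (Submodule.subset_span ⟨a i, ⟨i, hi, rfl⟩, rfl⟩)
  · have := Nat.find_spec hex
    rwa [hj, pow_succ', mul_smul] at this

lemma exists_mem_pWeakNormalization_notMem_seminormalization {n s : ℕ} {a : Fin s → (Fin n → ℤ)}
    {A : AddSubmonoid (Fin n → ℤ)} (hA : ∀ i, a i ∈ A) {p : ℕ} (hp : 0 < p)
    {S : Finset (Fin s)} {v : Fin n → ℤ}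
    (hG : v ∈ AddSubgroup.closure (A : Set (Fin n → ℤ)))
    (hv : v ∉ faceGroup A a S) (hpv : p • v ∈ faceGroup A a S) :
    ∃ u ∈ pWeakNormalization A p, u ∉ seminormalization A := by
  obtain ⟨M, hM⟩ := exists_nsmul_add_mem_faceSubmonoid hA (r := fun _ => p) (fun _ _ => hp) hpv
  have hw : ∑ i ∈ S, 1 • a i ∈ faceSubmonoid A a S := sum_nsmul_mem_faceSubmonoid hA S fun _ => 1
  simp only [one_smul] at hw
  set w := ∑ i ∈ S, a i
  have hpu : p • (v + M • w) ∈ faceSubmonoid A a S := by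
    convert hM using 1
    rw [smul_add, smul_comm p M, ← Finset.smul_sum]
  refine ⟨v + M • w, ⟨⟨add_mem hG (nsmul_mem (AddSubgroup.subset_closure hw.1) _), p, hp, hpu.1⟩,
    1, by simpa using hpu.1⟩, ?_⟩
  rintro ⟨-, m, m', -, -, hco, hm, hm'⟩
  have hface := mem_face_of_nsmul_mem_face hp hpu.2
  have hmul : ∀ k : ℕ, k • (v + M • w) ∈ A → k • (v + M • w) ∈ faceGroup A a S := fun k hk =>
    mem_faceGroup_of_mem ⟨hk, by rw [toR_nsmul]; exact smul_mem_face k.cast_nonneg hface⟩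
  have hu := (faceGroup A a S).mem_of_coprime_nsmul_mem hco (hmul m hm) (hmul m' hm')
  exact hv ((add_mem_cancel_right (nsmul_mem (mem_faceGroup_of_mem hw) M)).1 hu)

/-- `*pA ≠ ⁺A` iff there is a face `F_S` and `v ∈ G(A)` whose image lies
in the `ℝ`-span of `{a i : i ∈ S}` with `v ∉ G(A ∩ F_S)` and `p • v ∈ G(A ∩ F_S)`. -/
theorem stmt13 (n s : ℕ) (a : Fin s → (Fin n → ℤ)) (A : AddSubmonoid (Fin n → ℤ))
    (hgen : A = AddSubmonoid.closure (Set.range a))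
    (hnonneg : ∀ v ∈ A, ∀ i, 0 ≤ v i)
    (p : ℕ) (hp : p.Prime) :
    pWeakNormalization A p ≠ seminormalization A ↔
      ∃ (S : Finset (Fin s)) (v : Fin n → ℤ),
        v ∈ AddSubgroup.closure (A : Set (Fin n → ℤ)) ∧
        toR v ∈ Submodule.span ℝ (toR '' (a '' (S : Set (Fin s)))) ∧
        v ∉ faceGroup A a S ∧ p • v ∈ faceGroup A a S := by
  have hA : ∀ i, a i ∈ A := fun i => hgen ▸ AddSubmonoid.subset_closure ⟨i, rfl⟩
  constructor
  · intro hne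
    have hnot : ¬ pWeakNormalization A p ⊆ seminormalization A := fun h =>
      hne (h.antisymm (seminormalization_subset_pWeakNormalization A hp.one_lt))
    obtain ⟨v, hv, hv'⟩ := Set.not_subset.1 hnot
    subst hgen
    exact exists_faceGroup_torsion_of_notMem_seminormalization a hp hv hv'
  · rintro ⟨S, v, hG, -, hv, hpv⟩ heq
    obtain ⟨u, hu, hu'⟩ :=
      exists_mem_pWeakNormalization_notMem_seminormalization hA hp.pos hG hv hpv
    exact hu' (heq ▸ hu)
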